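/- arXiv:1010.5738 — 4 statements merged into one kernel-verified Lean document; each statement's English description precedes it below -/
import Mathlib

section
/- Let X, Y ∈ span_ℝ{j, k} ⊂ ℍ be orthonormal. Define R : ℍ → ℍ by R(V) = (7/2)·V·i − (15/2)·i·V and D : ℍ → ℍ by D(V) = (15/8)·(X·i − i·X)·V − (21/8)·V·(X·i − i·X). Then both R and D map span_ℝ{1, X} into span_ℝ{i, Y} and map span_ℝ{i, Y} into span_ℝ{1, X}. (R is the curvature tensor R^∇ of the normal connection of the soul and D is its covariant derivative D_X R^∇; this is the algebraic content of the splitting ℍ = σ₁ ⊕ σ₂ with σ₁ = span{1, X}, σ₂ = span{i, Y}.) -/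
open scoped Quaternion RealInnerProductSpace

noncomputable section

/-- The quaternion `i`. -/
def qi : ℍ := ⟨0, 1, 0, 0⟩

/-- The quaternion `j`. -/
def qj : ℍ := ⟨0, 0, 1, 0⟩

/-- The quaternion `k`. -/
def qk : ℍ := ⟨0, 0, 0, 1⟩

@[simp] lemma qi_re : qi.re = 0 := rfl
@[simp] lemma qi_imI : qi.imI = 1 := rfl
@[simp] lemma qi_imJ : qi.imJ = 0 := rfl
@[simp] lemma qi_imK : qi.imK = 0 := rfl
@[simp] lemma qj_re : qj.re = 0 := rfl
@[simp] lemma qj_imI : qj.imI = 0 := rfl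
@[simp] lemma qj_imJ : qj.imJ = 1 := rfl
@[simp] lemma qj_imK : qj.imK = 0 := rfl
@[simp] lemma qk_re : qk.re = 0 := rfl
@[simp] lemma qk_imI : qk.imI = 0 := rfl
@[simp] lemma qk_imJ : qk.imJ = 0 := rfl
@[simp] lemma qk_imK : qk.imK = 1 := rfl

/-- An orthonormal pair in `span{j, k}` is `aj + bk`, `e(-bj + ak)` with `a² + b² = 1` and
`e = ±1`. -/
lemma exists_coords_of_orthonormal {X Y : ℍ}
    (hX : X ∈ Submodule.span ℝ ({qj, qk} : Set ℍ)) (hXunit : ‖X‖ = 1)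
    (hY : Y ∈ Submodule.span ℝ ({qj, qk} : Set ℍ)) (hYunit : ‖Y‖ = 1)
    (hXY : ⟪X, Y⟫ = 0) :
    ∃ a b e : ℝ, a ^ 2 + b ^ 2 = 1 ∧ e ^ 2 = 1 ∧
      X = a • qj + b • qk ∧ Y = (-(e * b)) • qj + (e * a) • qk := by
  obtain ⟨a, b, rfl⟩ := Submodule.mem_span_pair.1 hX
  obtain ⟨c, d, rfl⟩ := Submodule.mem_span_pair.1 hY
  have hab : a ^ 2 + b ^ 2 = 1 := by
    have h := Quaternion.normSq_eq_norm_mul_self (a • qj + b • qk)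
    rw [hXunit, Quaternion.normSq_def'] at h
    simpa using h
  have hcd : c ^ 2 + d ^ 2 = 1 := by
    have h := Quaternion.normSq_eq_norm_mul_self (c • qj + d • qk)
    rw [hYunit, Quaternion.normSq_def'] at h
    simpa using h
  have horth : a * c + b * d = 0 := by
    rw [Quaternion.inner_def] at hXY
    simpa using hXY
  refine ⟨a, b, a * d - b * c, hab, ?_, ?_, ?_⟩
  · linear_combination (c ^ 2 + d ^ 2) * hab + hcd - (a * c + b * d) * horth
  · rfl
  · congr 2
    · linear_combination -c * hab + a * horth
    · linear_combination -d * hab + b * horth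

/-- For an orthonormal pair `X, Y ∈ span{j,k}`, the maps
`R(V) = (7/2)·V·i − (15/2)·i·V` and `D(V) = (15/8)(Xi − iX)V − (21/8)V(Xi − iX)`
interchange the planes `σ₁ = span{1, X}` and `σ₂ = span{i, Y}`. -/
theorem stmt_5 (X Y : ℍ)
    (hX : X ∈ Submodule.span ℝ ({qj, qk} : Set ℍ)) (hXunit : ‖X‖ = 1)
    (hY : Y ∈ Submodule.span ℝ ({qj, qk} : Set ℍ)) (hYunit : ‖Y‖ = 1)
    (hXY : ⟪X, Y⟫ = 0)
    (R D : ℍ → ℍ)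
    (hR : ∀ V : ℍ, R V = (7 / 2 : ℝ) • (V * qi) - (15 / 2 : ℝ) • (qi * V))
    (hD : ∀ V : ℍ, D V = (15 / 8 : ℝ) • ((X * qi - qi * X) * V)
      - (21 / 8 : ℝ) • (V * (X * qi - qi * X))) :
    (∀ V ∈ Submodule.span ℝ ({1, X} : Set ℍ), R V ∈ Submodule.span ℝ ({qi, Y} : Set ℍ)) ∧
    (∀ V ∈ Submodule.span ℝ ({qi, Y} : Set ℍ), R V ∈ Submodule.span ℝ ({1, X} : Set ℍ)) ∧
    (∀ V ∈ Submodule.span ℝ ({1, X} : Set ℍ), D V ∈ Submodule.span ℝ ({qi, Y} : Set ℍ)) ∧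
    (∀ V ∈ Submodule.span ℝ ({qi, Y} : Set ℍ), D V ∈ Submodule.span ℝ ({1, X} : Set ℍ)) := by
  obtain ⟨a, b, e, hab, he, rfl, rfl⟩ := exists_coords_of_orthonormal hX hXunit hY hYunit hXY
  simp only [hR, hD, Submodule.mem_span_pair]
  refine ⟨?_, ?_, ?_, ?_⟩ <;> rintro _ ⟨s, t, rfl⟩
  · refine ⟨-4 * s, -11 * e * t, ?_⟩
    ext <;> simp <;> grind
  · refine ⟨4 * s, 11 * e * t, ?_⟩
    ext <;> simp <;> grind
  · refine ⟨9 * t, 3 / 2 * e * s, ?_⟩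
    ext <;> simp <;> grind
  · refine ⟨-(3 / 2) * e * t, -9 * s, ?_⟩
    ext <;> simp <;> grind
end
end

section
/- For V = a + b·i + c·j + d·k and W = x + y·i + z·j + w·k in ℍ, define IN(V,W) = 188b²z² + 55d²x² + 512b²x² + 512a²y² + 1104d²z² + 1104c²w² + 55a²w² + 188c²y² + 1300bxdz − 1408bxcw − 1408aydz + 1300aycw − 2208dzcw − 1024bxay − 376cybz + 108cydx + 108awbz − 110awdx. Then IN(V,W) ≥ 0, and IN(V,W) = 0 if and only if V and W are linearly dependent over ℝ, or the real span of {V, W} equals span_ℝ{1, j}, or the real span of {V, W} equals span_ℝ{i, k}. (This characterizes exactly when the soul inequality is an equality at q₀ with X = 2j for the extended Wilking metric.) -/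
open scoped Quaternion

noncomputable section

lemma components_of_basis_expansion {V : ℍ} {a b c d : ℝ}
    (hV : V = (a : ℍ) + b • qi + c • qj + d • qk) :
    V.re = a ∧ V.imI = b ∧ V.imJ = c ∧ V.imK = d := by
  subst hV
  refine ⟨?_, ?_, ?_, ?_⟩ <;> simp <;> simp [qi, qj, qk]

/-- The excess polynomial is a sum of two positive definite binary quadratic forms in the minors of
the coordinate matrix, so it is nonnegative and vanishes only where these four minors do. -/
lemma excess_forms_nonneg_and_eq_zero_iff (p q r s : ℝ) :
    0 ≤ 512*p^2 - 1408*p*q + 1104*q^2 + (188*r^2 + 108*r*s + 55*s^2) ∧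
    (512*p^2 - 1408*p*q + 1104*q^2 + (188*r^2 + 108*r*s + 55*s^2) = 0 ↔
      p = 0 ∧ q = 0 ∧ r = 0 ∧ s = 0) := by
  have key : 512*p^2 - 1408*p*q + 1104*q^2 + (188*r^2 + 108*r*s + 55*s^2) =
      512*(p - 11/8*q)^2 + 136*q^2 + (188*(r + 27/94*s)^2 + 1856/47*s^2) := by ring
  refine ⟨by rw [key]; positivity, fun h => ?_, ?_⟩
  · rw [key] at h
    have hp := sq_nonneg (p - 11/8*q)
    have hq := sq_nonneg q
    have hr := sq_nonneg (r + 27/94*s)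
    have hs := sq_nonneg s
    have q0 : q = 0 := pow_eq_zero_iff two_ne_zero |>.mp (by linarith)
    have s0 : s = 0 := pow_eq_zero_iff two_ne_zero |>.mp (by linarith)
    have p0 : p - 11/8*q = 0 := pow_eq_zero_iff two_ne_zero |>.mp (by linarith)
    have r0 : r + 27/94*s = 0 := pow_eq_zero_iff two_ne_zero |>.mp (by linarith)
    exact ⟨by linarith, q0, by linarith, s0⟩
  · rintro ⟨rfl, rfl, rfl, rfl⟩
    norm_num

/-- Two quaternions are linearly dependent over `ℝ` iff all minors of their coordinate matrix
vanish. -/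
lemma not_linearIndependent_pair_iff_minors (V W : ℍ) :
    ¬ LinearIndependent ℝ ![V, W] ↔
      V.re*W.imI - V.imI*W.re = 0 ∧ V.re*W.imJ - V.imJ*W.re = 0 ∧
      V.re*W.imK - V.imK*W.re = 0 ∧ V.imI*W.imJ - V.imJ*W.imI = 0 ∧
      V.imI*W.imK - V.imK*W.imI = 0 ∧ V.imJ*W.imK - V.imK*W.imJ = 0 := by
  rw [LinearIndependent.pair_iff]
  simp only [Quaternion.ext_iff, Quaternion.re_add, Quaternion.imI_add, Quaternion.imJ_add,
    Quaternion.imK_add, Quaternion.re_smul, Quaternion.imI_smul, Quaternion.imJ_smul,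
    Quaternion.imK_smul, Quaternion.re_zero, Quaternion.imI_zero, Quaternion.imJ_zero,
    Quaternion.imK_zero, smul_eq_mul]
  constructor
  · intro h
    push Not at h
    obtain ⟨s, t, ⟨h0, h1, h2, h3⟩, hst⟩ := h
    have minor_eq_zero : ∀ {m n u v : ℝ}, s*m + t*u = 0 → s*n + t*v = 0 → m*v - n*u = 0 := by
      intro m n u v hm hn
      by_cases hs : s = 0
      · have ht := hst hs
        subst hs
        have hu : u = 0 := by simpa [ht] using hm
        have hv : v = 0 := by simpa [ht] using hn
        simp [hu, hv]
      · exact (mul_eq_zero.mp (by linear_combination v*hm - u*hn :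
          s*(m*v - n*u) = 0)).resolve_left hs
    exact ⟨minor_eq_zero h0 h1, minor_eq_zero h0 h2, minor_eq_zero h0 h3,
      minor_eq_zero h1 h2, minor_eq_zero h1 h3, minor_eq_zero h2 h3⟩
  · rintro ⟨h01, h02, h03, h12, h13, h23⟩ h
    have ha := (h W.re (-V.re) ⟨by ring, by linarith, by linarith, by linarith⟩).2
    have hb := (h W.imI (-V.imI) ⟨by linarith, by ring, by linarith, by linarith⟩).2
    have hc := (h W.imJ (-V.imJ) ⟨by linarith, by linarith, by ring, by linarith⟩).2
    have hd := (h W.imK (-V.imK) ⟨by linarith, by linarith, by linarith, by ring⟩).2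
    rw [neg_eq_zero] at ha hb hc hd
    exact one_ne_zero (h 1 0 (by simp [ha, hb, hc, hd])).1

/-- An invertible linear substitution does not change the span of a pair of vectors. -/
lemma span_pair_linear_combinations {M : Type*} [AddCommGroup M] [Module ℝ M] (e f : M)
    {m n u v : ℝ} (h : m*v - n*u ≠ 0) :
    Submodule.span ℝ ({m • e + n • f, u • e + v • f} : Set M) = Submodule.span ℝ {e, f} := by
  apply le_antisymm <;> rw [Submodule.span_le] <;> rintro p (rfl | rfl) <;>
    rw [SetLike.mem_coe, Submodule.mem_span_pair]
  · exact ⟨m, n, rfl⟩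
  · exact ⟨u, v, rfl⟩
  · refine ⟨(m*v - n*u)⁻¹*v, -(m*v - n*u)⁻¹*n, ?_⟩
    match_scalars
    · linear_combination inv_mul_cancel₀ h
    · ring
  · refine ⟨-(m*v - n*u)⁻¹*u, (m*v - n*u)⁻¹*m, ?_⟩
    match_scalars
    · ring
    · linear_combination inv_mul_cancel₀ h

lemma mem_span_one_qj {q : ℍ} (h : q ∈ Submodule.span ℝ ({1, qj} : Set ℍ)) :
    q.imI = 0 ∧ q.imK = 0 := by
  obtain ⟨s, t, rfl⟩ := Submodule.mem_span_pair.mp h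
  simp only [Quaternion.imI_add, Quaternion.imK_add, Quaternion.imI_smul, Quaternion.imK_smul]
  simp [qj]

lemma mem_span_qi_qk {q : ℍ} (h : q ∈ Submodule.span ℝ ({qi, qk} : Set ℍ)) :
    q.re = 0 ∧ q.imJ = 0 := by
  obtain ⟨s, t, rfl⟩ := Submodule.mem_span_pair.mp h
  simp only [Quaternion.re_add, Quaternion.imJ_add, Quaternion.re_smul, Quaternion.imJ_smul]
  simp [qi, qk]

/-- The soul-inequality excess `IN(V,W)` is nonnegative, and vanishes exactly when `V, W`
are linearly dependent, or `span{V,W} = span{1,j}`, or `span{V,W} = span{i,k}`. -/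
theorem stmt_11 (a b c d x y z w : ℝ) (V W : ℍ)
    (hV : V = (a : ℍ) + b • qi + c • qj + d • qk)
    (hW : W = (x : ℍ) + y • qi + z • qj + w • qk)
    (IN : ℝ)
    (hIN : IN = 188*b^2*z^2 + 55*d^2*x^2 + 512*b^2*x^2 + 512*a^2*y^2 + 1104*d^2*z^2
      + 1104*c^2*w^2 + 55*a^2*w^2 + 188*c^2*y^2
      + 1300*b*x*d*z - 1408*b*x*c*w - 1408*a*y*d*z + 1300*a*y*c*w - 2208*d*z*c*w
      - 1024*b*x*a*y - 376*c*y*b*z + 108*c*y*d*x + 108*a*w*b*z - 110*a*w*d*x) :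
    0 ≤ IN ∧
    (IN = 0 ↔
      ¬ LinearIndependent ℝ ![V, W] ∨
      Submodule.span ℝ ({V, W} : Set ℍ) = Submodule.span ℝ ({1, qj} : Set ℍ) ∨
      Submodule.span ℝ ({V, W} : Set ℍ) = Submodule.span ℝ ({qi, qk} : Set ℍ)) := by
  obtain ⟨hnonneg, hzero⟩ :=
    excess_forms_nonneg_and_eq_zero_iff (a*y - b*x) (d*z - c*w) (b*z - c*y) (a*w - d*x)
  have hforms : IN = 512*(a*y - b*x)^2 - 1408*(a*y - b*x)*(d*z - c*w) + 1104*(d*z - c*w)^2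
      + (188*(b*z - c*y)^2 + 108*(b*z - c*y)*(a*w - d*x) + 55*(a*w - d*x)^2) := by
    rw [hIN]; ring
  rw [← hforms] at hnonneg hzero
  refine ⟨hnonneg, ?_⟩
  rw [hzero]
  obtain ⟨hVre, hVi, hVj, hVk⟩ := components_of_basis_expansion hV
  obtain ⟨hWre, hWi, hWj, hWk⟩ := components_of_basis_expansion hW
  have hminors := not_linearIndependent_pair_iff_minors V W
  rw [hVre, hVi, hVj, hVk, hWre, hWi, hWj, hWk] at hminors
  constructor
  · rintro ⟨h01, h32, h12, h03⟩
    by_cases h02 : a*z - c*x = 0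
    · by_cases h13 : b*w - d*y = 0
      · exact Or.inl (hminors.mpr ⟨h01, h02, h03, h12, h13, by linarith⟩)
      · have ha : a = 0 := (mul_eq_zero.mp (by linear_combination b*h03 - d*h01 :
          a*(b*w - d*y) = 0)).resolve_right h13
        have hx : x = 0 := (mul_eq_zero.mp (by linear_combination y*h03 - w*h01 :
          x*(b*w - d*y) = 0)).resolve_right h13
        have hc : c = 0 := (mul_eq_zero.mp (by linear_combination -b*h32 + d*h12 :
          c*(b*w - d*y) = 0)).resolve_right h13
        have hz : z = 0 := (mul_eq_zero.mp (by linear_combination w*h12 - y*h32 :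
          z*(b*w - d*y) = 0)).resolve_right h13
        have hV' : V = b • qi + d • qk := by simpa [ha, hc] using hV
        have hW' : W = y • qi + w • qk := by simpa [hx, hz] using hW
        right; right
        rw [hV', hW', span_pair_linear_combinations qi qk h13]
    · have hb : b = 0 := (mul_eq_zero.mp (by linear_combination a*h12 + c*h01 :
        b*(a*z - c*x) = 0)).resolve_right h02
      have hy : y = 0 := (mul_eq_zero.mp (by linear_combination x*h12 + z*h01 :
        y*(a*z - c*x) = 0)).resolve_right h02
      have hd : d = 0 := (mul_eq_zero.mp (by linear_combination a*h32 + c*h03 :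
        d*(a*z - c*x) = 0)).resolve_right h02
      have hw : w = 0 := (mul_eq_zero.mp (by linear_combination x*h32 + z*h03 :
        w*(a*z - c*x) = 0)).resolve_right h02
      have hV' : V = a • (1 : ℍ) + c • qj := by
        simpa [hb, hd, Algebra.smul_def] using hV
      have hW' : W = x • (1 : ℍ) + z • qj := by
        simpa [hy, hw, Algebra.smul_def] using hW
      right; left
      rw [hV', hW', span_pair_linear_combinations 1 qj h02]
  · rintro (hdep | hspan | hspan)
    · obtain ⟨h01, -, h03, h12, -, h23⟩ := hminors.mp hdep
      exact ⟨h01, by linarith, h12, h03⟩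
    · obtain ⟨hb, hd⟩ := mem_span_one_qj (q := V) (hspan ▸ Submodule.mem_span_of_mem (by simp))
      obtain ⟨hy, hw⟩ := mem_span_one_qj (q := W) (hspan ▸ Submodule.mem_span_of_mem (by simp))
      simp [← hVi, ← hVk, ← hWi, ← hWk, hb, hd, hy, hw]
    · obtain ⟨ha, hc⟩ := mem_span_qi_qk (q := V) (hspan ▸ Submodule.mem_span_of_mem (by simp))
      obtain ⟨hx, hz⟩ := mem_span_qi_qk (q := W) (hspan ▸ Submodule.mem_span_of_mem (by simp))
      simp [← hVre, ← hVj, ← hWre, ← hWj, ha, hc, hx, hz]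
end
end

section
/- In ℍ⁶ with the componentwise real inner product, let E = {(p₁,...,p₆) ∈ ℍ⁶ : Re p₁ = Re p₃ = Re p₄ = Re p₅ = Re p₆ = 0}, let V̄ = {(G₁ − S, 0, −S, G₁ − T, G₂ − T, σ·i − T) : G₁, G₂, S, T ∈ Im ℍ, σ ∈ ℝ}, and let H = {(A, B, −A, −A, 0, A) : A ∈ span_ℝ{j, k}, B ∈ ℍ}. Then H equals the orthogonal complement of V̄ inside E, i.e. H = {h ∈ E : ⟨h, v⟩ = 0 for all v ∈ V̄}. (V̄ is the vertical space and H the horizontal space at the point q̄₀ = (1,0,1,1,1,1) of the Riemannian submersion defining the extended Wilking metric on S² × ℍ.) -/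
open scoped Quaternion RealInnerProductSpace

noncomputable section

/-- The componentwise real inner product on `ℍ⁶`. -/
def ip (p q : Fin 6 → ℍ) : ℝ := ∑ i, ⟪p i, q i⟫

/-- The vertical space `V̄` at `q̄₀ = (1,0,1,1,1,1)`. -/
def Vbar : Set (Fin 6 → ℍ) :=
  {v | ∃ G₁ G₂ S T : ℍ, ∃ σ : ℝ, G₁.re = 0 ∧ G₂.re = 0 ∧ S.re = 0 ∧ T.re = 0 ∧
    v = ![G₁ - S, 0, -S, G₁ - T, G₂ - T, σ • qi - T]}

theorem inner_qi (p : ℍ) : ⟪p, qi⟫ = p.imI := by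
  rw [Quaternion.inner_def, Quaternion.re_mul]
  simp only [Quaternion.re_star, Quaternion.imI_star, Quaternion.imJ_star, Quaternion.imK_star]
  simp [qi]

theorem mem_span_qj_qk_iff {A : ℍ} :
    A ∈ Submodule.span ℝ ({qj, qk} : Set ℍ) ↔ A.re = 0 ∧ A.imI = 0 := by
  rw [Submodule.mem_span_pair]
  constructor
  · rintro ⟨a, b, rfl⟩
    simp only [Quaternion.re_add, Quaternion.imI_add, Quaternion.re_smul, Quaternion.imI_smul]
    simp [qj, qk]
  · rintro ⟨hre, hi⟩
    refine ⟨A.imJ, A.imK, ?_⟩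
    ext <;>
      simp only [Quaternion.re_add, Quaternion.imI_add, Quaternion.imJ_add, Quaternion.imK_add,
        Quaternion.re_smul, Quaternion.imI_smul, Quaternion.imJ_smul, Quaternion.imK_smul] <;>
      simp [qj, qk, hre, hi]

/-- The pairing with a vertical vector, grouped by the parameters of that vector. -/
theorem ip_vertical (h : Fin 6 → ℍ) (G₁ G₂ S T : ℍ) (σ : ℝ) :
    ip h ![G₁ - S, 0, -S, G₁ - T, G₂ - T, σ • qi - T] =
      ⟪h 0 + h 3, G₁⟫ + ⟪h 4, G₂⟫ - ⟪h 0 + h 2, S⟫ - ⟪h 3 + h 4 + h 5, T⟫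
        + σ * ⟪h 5, qi⟫ := by
  simp only [ip, Fin.sum_univ_six, Matrix.cons_val, inner_sub_right, inner_neg_right,
    inner_zero_right, inner_add_left, real_inner_smul_right]
  ring

/-- The horizontal space at `q̄₀` is the orthogonal complement of the vertical space `V̄`
inside the tangent space `E`. -/
theorem stmt_14
    (E : Set (Fin 6 → ℍ))
    (hE : E = {p | (p 0).re = 0 ∧ (p 2).re = 0 ∧ (p 3).re = 0 ∧ (p 4).re = 0 ∧ (p 5).re = 0})
    (H : Set (Fin 6 → ℍ))
    (hH : H = {h | ∃ A B : ℍ, A ∈ Submodule.span ℝ ({qj, qk} : Set ℍ) ∧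
      h = ![A, B, -A, -A, 0, A]}) :
    H = {h | h ∈ E ∧ ∀ v ∈ Vbar, ip h v = 0} := by
  subst hE hH
  ext h
  simp only [Set.mem_ofPred_eq]
  constructor
  · rintro ⟨A, B, hA, rfl⟩
    obtain ⟨hre, hi⟩ := mem_span_qj_qk_iff.1 hA
    refine ⟨by simp [hre], ?_⟩
    rintro v ⟨G₁, G₂, S, T, σ, -, -, -, -, rfl⟩
    rw [ip_vertical]
    simp [inner_qi, hi]
  · rintro ⟨⟨h0, h2, h3, h4, h5⟩, hV⟩
    have key : ∀ G₁ G₂ S T : ℍ, ∀ σ : ℝ, G₁.re = 0 → G₂.re = 0 → S.re = 0 → T.re = 0 →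
        ⟪h 0 + h 3, G₁⟫ + ⟪h 4, G₂⟫ - ⟪h 0 + h 2, S⟫ - ⟪h 3 + h 4 + h 5, T⟫
          + σ * ⟪h 5, qi⟫ = 0 := fun G₁ G₂ S T σ e₁ e₂ e₃ e₄ => by
      rw [← ip_vertical]
      exact hV _ ⟨G₁, G₂, S, T, σ, e₁, e₂, e₃, e₄, rfl⟩
    have e03 : h 0 + h 3 = 0 := (inner_self_eq_zero (𝕜 := ℝ)).1 <| by
      simpa using key (h 0 + h 3) 0 0 0 0 (by simp [h0, h3]) rfl rfl rfl
    have e4 : h 4 = 0 := (inner_self_eq_zero (𝕜 := ℝ)).1 <| by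
      simpa only [inner_zero_right, zero_add, sub_zero, zero_mul, add_zero]
        using key 0 (h 4) 0 0 0 rfl h4 rfl rfl
    have e02 : h 0 + h 2 = 0 := (inner_self_eq_zero (𝕜 := ℝ)).1 <| by
      simpa only [inner_zero_right, zero_add, sub_zero, zero_sub, zero_mul, add_zero,
        neg_eq_zero] using key 0 0 (h 0 + h 2) 0 0 rfl rfl (by simp [h0, h2]) rfl
    have e345 : h 3 + h 4 + h 5 = 0 := (inner_self_eq_zero (𝕜 := ℝ)).1 <| by
      simpa only [inner_zero_right, zero_add, sub_zero, zero_sub, zero_mul, add_zero,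
        neg_eq_zero] using key 0 0 0 (h 3 + h 4 + h 5) 0 rfl rfl rfl (by simp [h3, h4, h5])
    have e5 : (h 5).imI = 0 := by
      simpa [inner_qi] using key 0 0 0 0 1 rfl rfl rfl rfl
    have h3' : h 3 = -h 0 := eq_neg_of_add_eq_zero_right e03
    have h2' : h 2 = -h 0 := eq_neg_of_add_eq_zero_right e02
    have h5' : h 5 = h 0 := by
      rw [e4, h3', add_zero, neg_add_eq_zero] at e345
      exact e345.symm
    refine ⟨h 0, h 1, mem_span_qj_qk_iff.2 ⟨h0, h5' ▸ e5⟩, ?_⟩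
    ext1 n
    fin_cases n <;> simp [h2', h3', e4, h5']
end
end

section
/- In ℍ⁶ with the componentwise real inner product, let V̄ = {(G₁ − S, 0, −S, G₁ − T, G₂ − T, σ·i − T) : G₁, G₂, S, T ∈ Im ℍ, σ ∈ ℝ}. For V, W ∈ ℍ set R̂ = Im(W · conj V), L̂ = Im(conj V · W), and S = (1/4)·(⟨3R̂ − L̂, j⟩·j + ⟨3R̂ − L̂, k⟩·k). Then the orthogonal projection of the vector (−R̂, 0, R̂ − L̂, R̂, −R̂, 0) ∈ ℍ⁶ onto the subspace V̄ equals (−R̂ + S, 0, R̂ − L̂ − S, R̂ − S, −R̂, S). (This computes the O'Neill A-tensor A(X̄, Ȳ) at q̄₀ for two vertical-fiber directions X̄ = (0,V,0,0,0,0), Ȳ = (0,W,0,0,0,0).) -/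
open scoped Quaternion RealInnerProductSpace

noncomputable section

/-- The orthogonal projection of `(−R̂, 0, R̂−L̂, R̂, −R̂, 0)` onto the vertical space `V̄`
is `(−R̂+S, 0, R̂−L̂−S, R̂−S, −R̂, S)`: the projection lies in `V̄` and the difference is
orthogonal to `V̄`. -/
theorem stmt_15 (V W : ℍ) (Rh Lh S : ℍ)
    (hRh : Rh = (W * star V).im)
    (hLh : Lh = (star V * W).im)
    (hS : S = (1 / 4 : ℝ) • (⟪(3 : ℝ) • Rh - Lh, qj⟫ • qj + ⟪(3 : ℝ) • Rh - Lh, qk⟫ • qk))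
    (u p : Fin 6 → ℍ)
    (hu : u = ![-Rh, 0, Rh - Lh, Rh, -Rh, 0])
    (hp : p = ![-Rh + S, 0, Rh - Lh - S, Rh - S, -Rh, S]) :
    p ∈ Vbar ∧ ∀ v ∈ Vbar, ip (u - p) v = 0 := by
  have hR0 : Rh.re = 0 := by simp [hRh]
  have hL0 : Lh.re = 0 := by simp [hLh]
  have hS0 : S.re = 0 := by simp [hS]
  have hSi : S.imI = 0 := by simp [hS]
  have hSj : S.imJ = (3 * Rh.imJ - Lh.imJ) / 4 := by
    simp [hS, Quaternion.inner_def]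
    ring
  have hSk : S.imK = (3 * Rh.imK - Lh.imK) / 4 := by
    simp [hS, Quaternion.inner_def]
    ring
  clear hS
  subst hu hp
  constructor
  · refine ⟨Lh + (2 : ℝ) • S - (2 : ℝ) • Rh, Lh + (3 : ℝ) • S - (4 : ℝ) • Rh, Lh + S - Rh,
      Lh + (3 : ℝ) • S - (3 : ℝ) • Rh, Lh.imI - 3 * Rh.imI, ?_, ?_, ?_, ?_, ?_⟩
    · simp [hR0, hL0, hS0]
    · simp [hR0, hL0, hS0]
    · simp [hR0, hL0, hS0]
    · simp [hR0, hL0, hS0]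
    · have hσ : S = (Lh.imI - 3 * Rh.imI) • qi - (Lh + (3 : ℝ) • S - (3 : ℝ) • Rh) := by
        ext <;> simp [hR0, hL0, hS0, hSi, hSj, hSk] <;> ring
      rw [← hσ]
      have h₀ : Lh + (2 : ℝ) • S - (2 : ℝ) • Rh - (Lh + S - Rh) = -Rh + S := by module
      have h₂ : -(Lh + S - Rh) = Rh - Lh - S := by module
      have h₃ : Lh + (2 : ℝ) • S - (2 : ℝ) • Rh - (Lh + (3 : ℝ) • S - (3 : ℝ) • Rh) = Rh - S := by
        module
      have h₄ : Lh + (3 : ℝ) • S - (4 : ℝ) • Rh - (Lh + (3 : ℝ) • S - (3 : ℝ) • Rh) = -Rh := by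
        module
      rw [h₀, h₂, h₃, h₄]
  · rintro v ⟨G₁, G₂, S', T, σ, -, -, -, -, rfl⟩
    have hSqi : ⟪S, qi⟫ = 0 := by simp [Quaternion.inner_def, hSi]
    simp [ip, Fin.sum_univ_succ, inner_sub_right, inner_smul_right, hSqi]
end
end
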